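/- The language of T-patterns over Σ = {a, b, c}, i.e., the set of hedges of the form a·…·a·b(b(…b(b)…))·c·…·c containing the same number n ≥ 1 of occurrences of a, of b, and of c (n leading leaves labeled a, followed by a chain of n nodes labeled b, followed by n leaves labeled c), is recognized by a bidimensional context-free hedge automaton. -/

import Mathlib

/-- Unranked trees over alphabet `α`, with variables indexed by `ℕ` at leaves. -/
inductive VTree (α : Type) : Type where
  | var : ℕ → VTree α
  | node : α → List (VTree α) → VTree α

/-- A hedge is a finite sequence of trees. -/
abbrev VHedge (α : Type) := List (VTree α)

/-- Relabeling of trees. -/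
def VTree.map {α β : Type} (f : α → β) : VTree α → VTree β
  | .var x => .var x
  | .node a ts => .node (f a) (ts.attach.map fun t => t.1.map f)
decreasing_by
  have := List.sizeOf_lt_of_mem t.2
  simp only [VTree.node.sizeOf_spec]
  omega

/-- Relabeling of hedges. -/
def hedgeMap {α β : Type} (f : α → β) (h : VHedge α) : VHedge β := h.map (VTree.map f)

/-- A tree is ground if it contains no variable. -/
inductive GroundT {α : Type} : VTree α → Prop where
  | node {a : α} {ts : List (VTree α)} : (∀ t ∈ ts, GroundT t) → GroundT (.node a ts)

/-- A hedge is ground (an element of `H(Σ)`) if all its trees are ground. -/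
def Ground {α : Type} (h : VHedge α) : Prop := ∀ t ∈ h, GroundT t

/-- A bidimensional context-free hedge automaton (CF²HA) over alphabet `S` with
states `Q`. A horizontal transition `p₁(δ₁)…pₙ(δₙ) → q(δ₁…δₙ)` is encoded as a
list of pairs `(pᵢ, bᵢ)` with `pᵢ ∈ S ⊕ Q` and `bᵢ : Bool` telling whether
`δᵢ` is a variable (`true`) or forced to be the empty hedge `ε` (`false`),
together with the target state `q`. A vertical transition `p₁(p₂(δ)) → q(δ)` is
encoded as `(p₁, p₂, b, q)`. Transition sets are finite. -/
structure CF2HA (S Q : Type) where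
  final : Set Q
  hor : Set (List ((S ⊕ Q) × Bool) × Q)
  ver : Set ((S ⊕ Q) × (S ⊕ Q) × Bool × Q)
  hor_fin : hor.Finite
  ver_fin : ver.Finite

/-- The move relation of a CF²HA: the rewrite relation on ground hedges over
`Σ ∪ Q` induced by its transitions (closed under contexts). -/
inductive CF2HA.Step {S Q : Type} (A : CF2HA S Q) :
    VHedge (S ⊕ Q) → VHedge (S ⊕ Q) → Prop where
  | hor {ps : List ((S ⊕ Q) × Bool)} {q : Q} (hs : List (VHedge (S ⊕ Q))) :
      (ps, q) ∈ A.hor → hs.length = ps.length →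
      (∀ pb ∈ List.zip ps hs, pb.1.2 = false → pb.2 = []) →
      CF2HA.Step A (List.zipWith (fun p h => VTree.node p.1 h) ps hs)
        [VTree.node (Sum.inr q) hs.flatten]
  | ver {p₁ p₂ : S ⊕ Q} {b : Bool} {q : Q} (h : VHedge (S ⊕ Q)) :
      (p₁, p₂, b, q) ∈ A.ver → (b = false → h = []) →
      CF2HA.Step A [VTree.node p₁ [VTree.node p₂ h]] [VTree.node (Sum.inr q) h]
  | ctx_hor {h h' : VHedge (S ⊕ Q)} (pre post : VHedge (S ⊕ Q)) :
      CF2HA.Step A h h' → CF2HA.Step A (pre ++ h ++ post) (pre ++ h' ++ post)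
  | ctx_ver {h h' : VHedge (S ⊕ Q)} (a : S ⊕ Q) :
      CF2HA.Step A h h' → CF2HA.Step A [VTree.node a h] [VTree.node a h']

/-- `L(A, q)`: ground hedges over `S` that reduce to `q(ε)`. -/
def CF2HA.stateLang {S Q : Type} (A : CF2HA S Q) (q : Q) : Set (VHedge S) :=
  { h | Ground h ∧
    Relation.ReflTransGen A.Step (hedgeMap Sum.inl h) [VTree.node (Sum.inr q) []] }

/-- `L(A)`: hedges accepted in some final state. -/
def CF2HA.lang {S Q : Type} (A : CF2HA S Q) : Set (VHedge S) :=
  { h | ∃ q ∈ A.final, h ∈ A.stateLang q }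


/-- The alphabet `Σ = {a, b, c}`. -/
inductive ABC : Type where
  | a : ABC
  | b : ABC
  | c : ABC
deriving DecidableEq

/-- `bpow n` is the nested tree `b^{n+1}`: `bpow 0 = b(ε)` and
`bpow (k+1) = b(bpow k)`. -/
def bpow : ℕ → VTree ABC
  | 0 => .node .b []
  | n + 1 => .node .b [bpow n]

/-- The language of T-patterns: for each `n ≥ 1`, `n` leaf trees `a(ε)`,
followed by the nested tree `bⁿ`, followed by `n` leaf trees `c(ε)`. -/
def TPatterns : Set (VHedge ABC) :=
  { h | ∃ n : ℕ,
      h = List.replicate (n + 1) (VTree.node ABC.a []) ++ [bpow n] ++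
          List.replicate (n + 1) (VTree.node ABC.c []) }


/-- Application of a transition at the root of a hedge: `A.RootStep l q x` says that
`l` is rewritten to the single tree `q(x)`. -/
inductive CF2HA.RootStep {S Q : Type} (A : CF2HA S Q) :
    VHedge (S ⊕ Q) → Q → VHedge (S ⊕ Q) → Prop where
  | hor {ps : List ((S ⊕ Q) × Bool)} {q : Q} (hs : List (VHedge (S ⊕ Q))) :
      (ps, q) ∈ A.hor → hs.length = ps.length →
      (∀ pb ∈ List.zip ps hs, pb.1.2 = false → pb.2 = []) →
      CF2HA.RootStep A (List.zipWith (fun p h => VTree.node p.1 h) ps hs) q hs.flatten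
  | ver {p₁ p₂ : S ⊕ Q} {b : Bool} {q : Q} (h : VHedge (S ⊕ Q)) :
      (p₁, p₂, b, q) ∈ A.ver → (b = false → h = []) →
      CF2HA.RootStep A [VTree.node p₁ [VTree.node p₂ h]] q h

/-- A move takes place either at the top level of the hedge or inside one of its trees. -/
theorem CF2HA.Step.top_or_inside {S Q : Type} {A : CF2HA S Q} {h h' : VHedge (S ⊕ Q)}
    (st : A.Step h h') :
    (∃ pre post l q x, A.RootStep l q x ∧ h = pre ++ l ++ post ∧
      h' = pre ++ VTree.node (Sum.inr q) x :: post) ∨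
    (∃ pre post p k k', A.Step k k' ∧ h = pre ++ VTree.node p k :: post ∧
      h' = pre ++ VTree.node p k' :: post) := by
  induction st with
  | hor hs h₁ h₂ h₃ => exact .inl ⟨[], [], _, _, _, .hor hs h₁ h₂ h₃, by simp, by simp⟩
  | ver x h₁ h₂ => exact .inl ⟨[], [], _, _, _, .ver x h₁ h₂, by simp, by simp⟩
  | ctx_hor pre post _ ih =>
    rcases ih with ⟨u, v, l, q, x, hr, rfl, rfl⟩ | ⟨u, v, p, k, k', hk, rfl, rfl⟩
    · exact .inl ⟨pre ++ u, v ++ post, l, q, x, hr, by simp, by simp⟩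
    · exact .inr ⟨pre ++ u, v ++ post, p, k, k', hk, by simp, by simp⟩
  | ctx_ver p st _ => exact .inr ⟨[], [], p, _, _, st, by simp, by simp⟩

namespace TPattern

/-- The automaton for T-patterns, with states `true` (final) and `false` and transitions
`a b(x) c → true(x)`, `a false(x) c → true(x)` and `true(b(x)) → false(x)`. -/
def automaton : CF2HA ABC Bool where
  final := {true}
  hor := {([(.inl .a, false), (.inl .b, true), (.inl .c, false)], true),
    ([(.inl .a, false), (.inr false, true), (.inl .c, false)], true)}
  ver := {(.inr true, .inl .b, true, false)}
  hor_fin := by simp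
  ver_fin := by simp

/-- The hedge over `Σ ∪ Q` consisting of a chain of `n` nodes labelled `b`. -/
def chain : ℕ → VHedge (ABC ⊕ Bool)
  | 0 => []
  | n + 1 => [.node (.inl .b) (chain n)]

/-- The tree `t` surrounded by `n` leaves `a` and `n` leaves `c`. -/
def surround (n : ℕ) (t : VTree (ABC ⊕ Bool)) : VHedge (ABC ⊕ Bool) :=
  List.replicate n (.node (.inl .a) []) ++ t :: List.replicate n (.node (.inl .c) [])

theorem surround_succ (n : ℕ) (t : VTree (ABC ⊕ Bool)) :
    surround (n + 1) t = List.replicate n (.node (.inl .a) []) ++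
      [.node (.inl .a) [], t, .node (.inl .c) []] ++
      List.replicate n (.node (.inl .c) []) := by
  rw [surround, List.replicate_succ', List.replicate_succ]
  simp

/-- The hedges that reduce to `true(ε)`. -/
inductive Reducible : VHedge (ABC ⊕ Bool) → Prop where
  | final (n : ℕ) : Reducible (surround n (.node (.inr true) (chain n)))
  | aux (n : ℕ) : Reducible (surround (n + 1) (.node (.inr false) (chain n)))
  | start (n : ℕ) : Reducible (surround (n + 1) (.node (.inl .b) (chain n)))

theorem rootStep_cases {l x : VHedge (ABC ⊕ Bool)} {q : Bool} (h : automaton.RootStep l q x) :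
    (q = true ∧ ∃ p, (p = .inl .b ∨ p = .inr false) ∧
      l = [.node (.inl .a) [], .node p x, .node (.inl .c) []]) ∨
    (q = false ∧ l = [.node (.inr true) [.node (.inl .b) x]]) := by
  cases h with
  | hor hs h₁ h₂ h₃ =>
    simp only [automaton, Set.mem_insert_iff, Set.mem_singleton_iff, Prod.mk.injEq] at h₁
    rcases h₁ with ⟨rfl, rfl⟩ | ⟨rfl, rfl⟩ <;>
    · obtain ⟨u, v, w, rfl⟩ := List.length_eq_three.mp h₂
      simp at h₃
      simp [h₃]
  | ver _ h₁ _ =>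
    simp only [automaton, Set.mem_singleton_iff, Prod.mk.injEq] at h₁
    obtain ⟨rfl, rfl, rfl, rfl⟩ := h₁
    simp

theorem not_step_chain (n : ℕ) (k : VHedge (ABC ⊕ Bool)) : ¬ automaton.Step k (chain n) := by
  induction n generalizing k with
  | zero =>
    intro st
    rcases st.top_or_inside with ⟨u, v, l, q, x, -, -, h⟩ | ⟨u, v, p, k, k', -, -, h⟩ <;>
      simp [chain] at h
  | succ n ih =>
    intro st
    rcases st.top_or_inside with ⟨u, v, l, q, x, -, -, h⟩ | ⟨u, v, p, k, k', hk, -, h⟩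
    · simp [chain, List.cons_eq_append_iff] at h
    · simp [chain, List.cons_eq_append_iff] at h
      obtain ⟨-, ⟨-, rfl⟩, -⟩ := h
      exact ih _ hk

/-- The only tree labelled by a state in `surround n t` can be `t`. -/
theorem append_eq_surround {pre post x : VHedge (ABC ⊕ Bool)} {q : Bool} {n : ℕ}
    {t : VTree (ABC ⊕ Bool)} (h : pre ++ .node (.inr q) x :: post = surround n t) :
    pre = List.replicate n (.node (.inl .a) []) ∧ t = .node (.inr q) x ∧
      post = List.replicate n (.node (.inl .c) []) := by
  rw [surround, List.append_eq_append_iff] at h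
  rcases h with ⟨u, h₁, h₂⟩ | ⟨u, h₁, h₂⟩
  · cases u with
    | nil => simp_all
    | cons y u =>
      simp only [List.cons_append, List.cons.injEq] at h₂
      have : y ∈ List.replicate n (VTree.node (Sum.inl ABC.a : ABC ⊕ Bool) []) := by
        simp [h₁]
      simp [← h₂.1] at this
  · cases u with
    | nil => simp_all
    | cons y u =>
      simp only [List.cons_append, List.cons.injEq] at h₂
      have : VTree.node (.inr q) x ∈
          List.replicate n (VTree.node (Sum.inl ABC.c : ABC ⊕ Bool) []) := by
        simp [h₂.2]
      simp at this

theorem Reducible.exists_chain {h k : VHedge (ABC ⊕ Bool)} {p : ABC ⊕ Bool}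
    (hr : Reducible h) (hm : .node p k ∈ h) : ∃ n, k = chain n := by
  cases hr <;>
  · simp only [surround, List.mem_append, List.mem_cons, List.mem_replicate,
      VTree.node.injEq] at hm
    rcases hm with ⟨-, -, hk⟩ | ⟨-, hk⟩ | ⟨-, -, hk⟩
    exacts [⟨0, hk⟩, ⟨_, hk⟩, ⟨0, hk⟩]

theorem Reducible.of_step {h h' : VHedge (ABC ⊕ Bool)} (st : automaton.Step h h')
    (hr : Reducible h') : Reducible h := by
  rcases st.top_or_inside with ⟨u, v, l, q, x, hl, rfl, rfl⟩ | ⟨u, v, p, k, k', hk, rfl, rfl⟩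
  · generalize hw : u ++ VTree.node (Sum.inr q) x :: v = w at hr
    cases hr with
    | final n =>
      obtain ⟨rfl, ht, rfl⟩ := append_eq_surround hw
      simp only [VTree.node.injEq, Sum.inr.injEq] at ht
      obtain ⟨rfl, rfl⟩ := ht
      rcases rootStep_cases hl with ⟨-, p, rfl | rfl, rfl⟩ | ⟨hq, -⟩
      · rw [← surround_succ]; exact .start n
      · rw [← surround_succ]; exact .aux n
      · cases hq
    | aux n =>
      obtain ⟨rfl, ht, rfl⟩ := append_eq_surround hw
      simp only [VTree.node.injEq, Sum.inr.injEq] at ht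
      obtain ⟨rfl, rfl⟩ := ht
      rcases rootStep_cases hl with ⟨hq, -⟩ | ⟨-, rfl⟩
      · cases hq
      · simpa [surround, chain] using Reducible.final (n + 1)
    | start n =>
      obtain ⟨-, ht, -⟩ := append_eq_surround hw
      cases ht
  · obtain ⟨n, rfl⟩ := hr.exists_chain (p := p) (k := k') (by simp)
    exact absurd hk (not_step_chain n k)

theorem reducible_of_reduces {h : VHedge (ABC ⊕ Bool)}
    (hs : Relation.ReflTransGen automaton.Step h [.node (.inr true) []]) : Reducible h := by
  induction hs using Relation.ReflTransGen.head_induction_on with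
  | refl => exact .final 0
  | head st _ ih => exact ih.of_step st

theorem step_surround {p : ABC ⊕ Bool} (hp : p = .inl .b ∨ p = .inr false) (n : ℕ)
    (x : VHedge (ABC ⊕ Bool)) :
    automaton.Step (surround (n + 1) (.node p x)) (surround n (.node (.inr true) x)) := by
  have := CF2HA.Step.hor (A := automaton)
    (ps := [(.inl .a, false), (p, true), (.inl .c, false)]) (q := true) [[], x, []]
    (by rcases hp with rfl | rfl <;> simp [automaton]) rfl (by simp)
  have := this.ctx_hor (List.replicate n (.node (.inl .a) []))
    (List.replicate n (.node (.inl .c) []))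
  rw [surround_succ]
  simpa [surround] using this

theorem reduces_final (n : ℕ) :
    Relation.ReflTransGen automaton.Step (surround n (.node (.inr true) (chain n)))
      [.node (.inr true) []] := by
  induction n with
  | zero => exact .refl
  | succ n ih =>
    refine .head ?_ (.head (step_surround (.inr rfl) n (chain n)) ih)
    have := CF2HA.Step.ver (A := automaton) (p₁ := .inr true) (p₂ := .inl .b) (b := true)
      (q := false) (chain n) (by simp [automaton]) (by simp)
    have := this.ctx_hor (List.replicate (n + 1) (.node (.inl .a) []))
      (List.replicate (n + 1) (.node (.inl .c) []))
    simpa only [surround, chain, List.append_assoc, List.singleton_append] using this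

theorem map_node {α β : Type} (f : α → β) (a : α) (ts : List (VTree α)) :
    (VTree.node a ts).map f = .node (f a) (ts.map (VTree.map f)) := by
  simp [VTree.map]

theorem map_inl_eq_node {t : VTree ABC} {s : ABC} {k : VHedge (ABC ⊕ Bool)} :
    t.map Sum.inl = .node (.inl s) k ↔ ∃ ts, t = .node s ts ∧ ts.map (VTree.map Sum.inl) = k := by
  cases t with
  | var => simp [VTree.map]
  | node r ts => simp [map_node]

theorem map_inl_eq_chain (n : ℕ) {t : VTree ABC} :
    t.map Sum.inl = .node (.inl .b) (chain n) ↔ t = bpow n := by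
  induction n generalizing t with
  | zero => simp [map_inl_eq_node, chain, bpow]
  | succ n ih => simp [map_inl_eq_node, chain, bpow, List.map_eq_singleton_iff, ih]

theorem map_inl_eq_leaf {t : VTree ABC} {s : ABC} :
    t.map Sum.inl = .node (.inl s : ABC ⊕ Bool) [] ↔ t = .node s [] := by
  simp [map_inl_eq_node]

theorem map_inl_ne_state {t : VTree ABC} {q : Bool} {k : VHedge (ABC ⊕ Bool)} :
    t.map Sum.inl ≠ .node (.inr q) k := by
  cases t <;> simp [VTree.map]

theorem map_eq_replicate_leaf {h : VHedge ABC} {s : ABC} {n : ℕ} :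
    h.map (VTree.map Sum.inl) = List.replicate n (.node (.inl s : ABC ⊕ Bool) []) ↔
      h = List.replicate n (.node s []) := by
  simp [List.eq_replicate_iff, map_inl_eq_leaf]

theorem hedgeMap_eq_surround {h : VHedge ABC} {n : ℕ} {t : VTree (ABC ⊕ Bool)} :
    hedgeMap Sum.inl h = surround n t ↔ ∃ u : VTree ABC, u.map Sum.inl = t ∧
      h = List.replicate n (.node .a []) ++ [u] ++ List.replicate n (.node .c []) := by
  simp only [hedgeMap, surround, List.map_eq_append_iff, List.map_eq_cons_iff,
    map_eq_replicate_leaf]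
  constructor
  · rintro ⟨_, _, rfl, rfl, u, _, rfl, hu, rfl⟩
    exact ⟨u, hu, by simp⟩
  · rintro ⟨u, hu, rfl⟩
    exact ⟨_, _, by rw [List.append_assoc, List.singleton_append], rfl, u, _, rfl, hu, rfl⟩

theorem groundT_leaf {α : Type} (a : α) : GroundT (.node a []) := .node (by simp)

theorem groundT_bpow (n : ℕ) : GroundT (bpow n) := by
  induction n with
  | zero => exact groundT_leaf _
  | succ n ih => exact .node (by simpa using ih)

theorem lang_automaton : automaton.lang = TPatterns := by
  ext h
  constructor
  · rintro ⟨q, rfl, -, hs⟩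
    generalize hw : hedgeMap Sum.inl h = w at hs
    cases reducible_of_reduces hs with
    | final n =>
      obtain ⟨u, hu, -⟩ := hedgeMap_eq_surround.mp hw
      exact absurd hu map_inl_ne_state
    | aux n =>
      obtain ⟨u, hu, -⟩ := hedgeMap_eq_surround.mp hw
      exact absurd hu map_inl_ne_state
    | start n =>
      obtain ⟨u, hu, rfl⟩ := hedgeMap_eq_surround.mp hw
      rw [map_inl_eq_chain] at hu
      exact ⟨n, by rw [hu]⟩
  · rintro ⟨n, rfl⟩
    refine ⟨true, rfl, ?_, ?_⟩
    · intro t ht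
      simp only [List.mem_append, List.mem_replicate, List.mem_singleton] at ht
      rcases ht with (⟨-, rfl⟩ | rfl) | ⟨-, rfl⟩
      exacts [groundT_leaf _, groundT_bpow n, groundT_leaf _]
    · rw [hedgeMap_eq_surround.mpr ⟨bpow n, (map_inl_eq_chain n).mpr rfl, rfl⟩]
      exact .head (step_surround (.inl rfl) n _) (reduces_final n)

end TPattern

/-- The language of T-patterns over `Σ = {a, b, c}` is recognized by a
bidimensional context-free hedge automaton. -/
theorem tpatterns_is_cf2ha :
    ∃ (Q : Type) (_ : Finite Q) (A : CF2HA ABC Q), A.lang = TPatterns :=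
  ⟨Bool, inferInstance, TPattern.automaton, TPattern.lang_automaton⟩
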